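/- Let C = [c_{ij}] be a real symmetric N×N matrix with zero row sums and with c_{ij} ≤ 0 for all i ≠ j, let f : ℝ^n → ℝ^n satisfy the QUAD condition with symmetric positive semidefinite matrix F, let s ∈ ℝ^n, let x_1, …, x_N ∈ ℝ^n, and set e_i = x_i − s, with e ∈ ℝ^{Nn} the concatenation of e_1, …, e_N. Then Σ_{i=1}^N Σ_{j=1}^N c_{ij}·e_iᵀ f(x_j) ≤ eᵀ (C ⊗ F) e. -/

import Mathlib

open Matrix Kronecker

/-- For a symmetric matrix with zero row sums, the bilinear form `∑ᵢⱼ Cᵢⱼ uᵢᵀ vⱼ` is a weighted sum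
over pairwise differences. -/
theorem sum_mul_dotProduct_sub_sub {ι κ R : Type*} [Fintype ι] [Fintype κ] [CommRing R]
    {C : Matrix ι ι R} (hsymm : C.IsSymm) (hrow : ∀ i, ∑ j, C i j = 0) (u v : ι → κ → R) :
    ∑ i, ∑ j, C i j * ((u i - u j) ⬝ᵥ (v i - v j)) = -2 * ∑ i, ∑ j, C i j * (u i ⬝ᵥ v j) := by
  have hdiag : ∑ i, ∑ j, C i j * (u i ⬝ᵥ v i) = 0 := by
    simp [← Finset.sum_mul, hrow]
  have hdiag_swap : ∑ i, ∑ j, C i j * (u j ⬝ᵥ v j) = 0 := by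
    rw [Finset.sum_comm, ← hdiag]
    simp only [hsymm.apply]
  have hcross_swap : ∑ i, ∑ j, C i j * (u j ⬝ᵥ v i) = ∑ i, ∑ j, C i j * (u i ⬝ᵥ v j) := by
    rw [Finset.sum_comm]
    simp only [hsymm.apply]
  simp only [sub_dotProduct, dotProduct_sub, mul_sub, Finset.sum_sub_distrib, hdiag, hdiag_swap,
    hcross_swap]
  ring

/-- The quadratic form of a Kronecker product, written blockwise. -/
theorem dotProduct_kronecker_mulVec {ι κ R : Type*} [Fintype ι] [Fintype κ] [CommRing R]
    (C : Matrix ι ι R) (F : Matrix κ κ R) (e : ι → κ → R) :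
    (fun p : ι × κ => e p.1 p.2) ⬝ᵥ (C ⊗ₖ F) *ᵥ (fun p : ι × κ => e p.1 p.2) =
      ∑ i, ∑ j, C i j * (e i ⬝ᵥ F *ᵥ e j) := by
  simp only [dotProduct, mulVec, kroneckerMap_apply, Fintype.sum_prod_type, Finset.mul_sum]
  refine Finset.sum_congr rfl fun i _ => ?_
  rw [Finset.sum_comm]
  refine Finset.sum_congr rfl fun j _ => Finset.sum_congr rfl fun a _ =>
    Finset.sum_congr rfl fun b _ => by ring

/-- Let `C` be a real symmetric `N × N` matrix with zero row sums and nonpositive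
off-diagonal entries, let `f` satisfy the QUAD condition with symmetric positive
semidefinite `F`, and set `e_i = x_i − s` with stacked vector `e`. Then
`Σᵢ Σⱼ cᵢⱼ·eᵢᵀ f(xⱼ) ≤ eᵀ (C ⊗ F) e`. -/
theorem stmt_13 {N n : ℕ} (C : Matrix (Fin N) (Fin N) ℝ)
    (hsymm : C.IsSymm) (hrow : ∀ i, ∑ j, C i j = 0)
    (hoff : ∀ i j, i ≠ j → C i j ≤ 0)
    (f : (Fin n → ℝ) → (Fin n → ℝ))
    (F : Matrix (Fin n) (Fin n) ℝ) (hF : F.PosSemidef)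
    (hquad : ∀ x y : Fin n → ℝ, (x - y) ⬝ᵥ (f x - f y) ≤ (x - y) ⬝ᵥ F *ᵥ (x - y))
    (s : Fin n → ℝ) (x : Fin N → (Fin n → ℝ))
    (e : Fin N → (Fin n → ℝ)) (he : ∀ i, e i = x i - s) :
    ∑ i, ∑ j, C i j * (e i ⬝ᵥ f (x j))
      ≤ (fun p : Fin N × Fin n => e p.1 p.2) ⬝ᵥ
          (C ⊗ₖ F) *ᵥ (fun p : Fin N × Fin n => e p.1 p.2) := by
  have hdiff : ∀ i j, e i - e j = x i - x j := fun i j => by simp [he]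
  have hsum : ∑ i, ∑ j, C i j * ((e i - e j) ⬝ᵥ (F *ᵥ e i - F *ᵥ e j)) ≤
      ∑ i, ∑ j, C i j * ((e i - e j) ⬝ᵥ (f (x i) - f (x j))) := by
    refine Finset.sum_le_sum fun i _ => Finset.sum_le_sum fun j _ => ?_
    rcases eq_or_ne i j with rfl | hij
    · simp
    · rw [← mulVec_sub, hdiff]
      exact mul_le_mul_of_nonpos_left (hquad _ _) (hoff i j hij)
  rw [sum_mul_dotProduct_sub_sub hsymm hrow e fun i => F *ᵥ e i,
    sum_mul_dotProduct_sub_sub hsymm hrow e fun i => f (x i)] at hsum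
  rw [dotProduct_kronecker_mulVec]
  linarith
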